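/- arXiv:2507.17525 — 7 statements merged into one kernel-verified Lean document; each statement's English description precedes it below -/
import Mathlib

section
/- Let A, B ∈ 𝓛(ℋ) be selfadjoint with B indefinite. Then there exists λ ∈ ℝ such that A + λB ≥ 0 if and only if ⟨Ax, x⟩ ≥ 0 for every x ∈ ℋ with ⟨Bx, x⟩ = 0. -/
open scoped InnerProductSpace

variable {H : Type*} [NormedAddCommGroup H] [InnerProductSpace ℂ H] [CompleteSpace H]

/-- The real quadratic form `x ↦ Re⟨B x, x⟩` associated to a bounded operator `B`. -/
noncomputable def qf (B : H →L[ℂ] H) (x : H) : ℝ := (⟪B x, x⟫_ℂ).re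

/-- An operator `A` is positive semidefinite if `⟨A x, x⟩ ≥ 0` for all `x`. -/
def PosSemidef (A : H →L[ℂ] H) : Prop := ∀ x : H, 0 ≤ qf A x

/-- A selfadjoint operator is indefinite if its quadratic form takes both strictly
positive and strictly negative values. -/
def Indefinite (B : H →L[ℂ] H) : Prop := (∃ x : H, 0 < qf B x) ∧ (∃ x : H, qf B x < 0)

theorem qf_smul_add_smul {B : H →L[ℂ] H} (hB : IsSelfAdjoint B) (x y : H) (s t : ℝ) :
    qf B ((s : ℂ) • x + (t : ℂ) • y) =
      s ^ 2 * qf B x + t ^ 2 * qf B y + 2 * s * t * (⟪B x, y⟫_ℂ).re := by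
  have hsymm : (⟪B y, x⟫_ℂ).re = (⟪B x, y⟫_ℂ).re := by
    have h : ⟪B y, x⟫_ℂ = ⟪y, B x⟫_ℂ := hB.isSymmetric y x
    rw [h, ← inner_conj_symm, Complex.conj_re]
  simp only [qf, map_add, map_smul, inner_add_left, inner_add_right, inner_smul_left,
    inner_smul_right, Complex.conj_ofReal, Complex.add_re, Complex.re_ofReal_mul, hsymm]
  ring

theorem qf_smul {E : Type*} [NormedAddCommGroup E] [InnerProductSpace ℂ E]
    (B : E →L[ℂ] E) (c : ℂ) (x : E) :
    qf B (c • x) = Complex.normSq c * qf B x := by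
  simp only [qf, map_smul, inner_smul_left, inner_smul_right]
  rw [← mul_assoc, mul_comm c, ← Complex.normSq_eq_conj_mul_self, Complex.re_ofReal_mul]

theorem qf_add_real_smul {E : Type*} [NormedAddCommGroup E] [InnerProductSpace ℂ E]
    (A B : E →L[ℂ] E) (l : ℝ) (x : E) :
    qf (A + l • B) x = qf A x + l * qf B x := by
  have h : (l • B) x = (l : ℂ) • B x := by simp
  simp only [qf, add_apply, h, inner_add_left, inner_smul_left, Complex.conj_ofReal,
    Complex.add_re, Complex.re_ofReal_mul]

/-- Some nonzero multiple of `y` is orthogonal to `z` for the real inner product. -/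
theorem exists_ne_zero_re_inner_smul_eq_zero {E : Type*} [NormedAddCommGroup E] [InnerProductSpace ℂ E]
    (z y : E) :
    ∃ c : ℂ, c ≠ 0 ∧ (⟪z, c • y⟫_ℂ).re = 0 := by
  by_cases hw : ⟪z, y⟫_ℂ = 0
  · exact ⟨1, one_ne_zero, by simp [hw]⟩
  · refine ⟨Complex.I * (starRingEnd ℂ) ⟪z, y⟫_ℂ, mul_ne_zero Complex.I_ne_zero (by rwa [map_ne_zero]), ?_⟩
    rw [inner_smul_right, mul_assoc, ← Complex.normSq_eq_conj_mul_self]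
    simp

theorem cross_nonneg_of_re_inner_eq_zero {A B : H →L[ℂ] H} (hA : IsSelfAdjoint A)
    (hB : IsSelfAdjoint B) (h : ∀ x : H, qf B x = 0 → 0 ≤ qf A x) {x y : H}
    (hx : 0 < qf B x) (hy : qf B y < 0) (hxy : (⟪B x, y⟫_ℂ).re = 0) :
    0 ≤ -qf B y * qf A x + qf B x * qf A y := by
  have hs : √(-qf B y) ^ 2 = -qf B y := Real.sq_sqrt (by linarith)
  have ht : √(qf B x) ^ 2 = qf B x := Real.sq_sqrt hx.le
  have h₁ := h ((√(-qf B y) : ℂ) • x + (√(qf B x) : ℂ) • y) (by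
    rw [qf_smul_add_smul hB, hxy, hs, ht]; ring)
  have h₂ := h ((√(-qf B y) : ℂ) • x + ((-√(qf B x) : ℝ) : ℂ) • y) (by
    rw [qf_smul_add_smul hB, hxy, neg_sq, hs, ht]; ring)
  rw [qf_smul_add_smul hA, hs, ht] at h₁
  rw [qf_smul_add_smul hA, neg_sq, hs, ht] at h₂
  linarith

theorem cross_nonneg {A B : H →L[ℂ] H} (hA : IsSelfAdjoint A)
    (hB : IsSelfAdjoint B) (h : ∀ x : H, qf B x = 0 → 0 ≤ qf A x) {x y : H}
    (hx : 0 < qf B x) (hy : qf B y < 0) :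
    0 ≤ -qf B y * qf A x + qf B x * qf A y := by
  obtain ⟨c, hc, hxy⟩ := exists_ne_zero_re_inner_smul_eq_zero (B x) y
  have hn : 0 < Complex.normSq c := Complex.normSq_pos.2 hc
  have key := cross_nonneg_of_re_inner_eq_zero hA hB h hx
    (by rw [qf_smul]; exact mul_neg_of_pos_of_neg hn hy) hxy
  rw [qf_smul, qf_smul] at key
  refine nonneg_of_mul_nonneg_right (a := Complex.normSq c) ?_ hn
  linarith

/-- **Krein–Šmul'jan theorem** (feasibility part): for selfadjoint `A` and indefinite
selfadjoint `B`, there is `λ ∈ ℝ` with `A + λB ≥ 0` iff `⟨Ax, x⟩ ≥ 0` whenever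
`⟨Bx, x⟩ = 0`. -/
theorem krein_smuljan (A B : H →L[ℂ] H) (hA : IsSelfAdjoint A) (hB : IsSelfAdjoint B)
    (hBind : Indefinite B) :
    (∃ l : ℝ, PosSemidef (A + l • B)) ↔ (∀ x : H, qf B x = 0 → 0 ≤ qf A x) := by
  constructor
  · rintro ⟨l, hl⟩ x hx
    simpa [qf_add_real_smul, hx] using hl x
  · intro h
    obtain ⟨⟨p, hp⟩, n, hn⟩ := hBind
    obtain ⟨l, hl, hu⟩ := exists_between_of_forall_le
      (s := (fun x => -qf A x / qf B x) '' {x | 0 < qf B x})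
      (t := (fun y => qf A y / -qf B y) '' {y | qf B y < 0})
      ⟨_, p, hp, rfl⟩ ⟨_, n, hn, rfl⟩ (by
        rintro _ ⟨x, hx, rfl⟩ _ ⟨y, hy, rfl⟩
        rw [Set.mem_ofPred_eq] at hx hy
        rw [div_le_div_iff₀ hx (neg_pos.2 hy)]
        linarith [cross_nonneg hA hB h hx hy])
    refine ⟨l, fun x => ?_⟩
    rw [qf_add_real_smul]
    rcases lt_trichotomy (qf B x) 0 with hx | hx | hx
    · have hlx := hu ⟨x, hx, rfl⟩
      rw [le_div_iff₀ (neg_pos.2 hx)] at hlx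
      linarith
    · simpa [hx] using h x hx
    · have hlx := hl ⟨x, hx, rfl⟩
      rw [div_le_iff₀ hx] at hlx
      linarith
end

section
/- A selfadjoint operator B ∈ 𝓛(ℋ) is indefinite if and only if there exists x ∈ ℋ such that ⟨Bx, x⟩ = 0 and Bx ≠ 0. -/
open scoped InnerProductSpace

variable {H : Type*} [NormedAddCommGroup H] [InnerProductSpace ℂ H] [CompleteSpace H]

/-- Expansion of the quadratic form of a selfadjoint operator along a real line. -/
theorem qf_add_smul (B : H →L[ℂ] H) (hB : IsSelfAdjoint B) (x y : H) (t : ℝ) :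
    qf B (x + (t : ℂ) • y) = qf B x + 2 * t * (⟪B x, y⟫_ℂ).re + t ^ 2 * qf B y := by
  have hsymm : (⟪B y, x⟫_ℂ).re = (⟪B x, y⟫_ℂ).re := by
    rw [← ContinuousLinearMap.adjoint_inner_right, hB.adjoint_eq]
    exact inner_re_symm (𝕜 := ℂ) y (B x)
  simp only [qf, map_add, map_smul, inner_add_left, inner_add_right, inner_smul_left,
    inner_smul_right, Complex.conj_ofReal, Complex.add_re, Complex.re_ofReal_mul, hsymm]
  ring

/-- A selfadjoint operator `B` is indefinite iff there exists `x` with `⟨Bx, x⟩ = 0`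
and `Bx ≠ 0`. -/
theorem indefinite_iff_exists_neutral_not_in_kernel (B : H →L[ℂ] H)
    (hB : IsSelfAdjoint B) :
    Indefinite B ↔ ∃ x : H, qf B x = 0 ∧ B x ≠ 0 := by
  constructor
  · rintro ⟨⟨u, hu⟩, v, hv⟩
    set b := (⟪B u, v⟫_ℂ).re with hb
    set t := (-b + √(b ^ 2 - qf B u * qf B v)) / qf B v with ht
    have hsq : √(b ^ 2 - qf B u * qf B v) ^ 2 = b ^ 2 - qf B u * qf B v :=
      Real.sq_sqrt (by nlinarith [sq_nonneg b, mul_neg_of_pos_of_neg hu hv])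
    have hroot : qf B (u + (t : ℂ) • v) = 0 := by
      rw [qf_add_smul B hB, ← hb, ht]
      have hv0 := hv.ne
      field_simp
      linear_combination hsq
    refine ⟨u + (t : ℂ) • v, hroot, fun hker => ?_⟩
    have h := qf_add_smul B hB (u + (t : ℂ) • v) v (-t)
    rw [hroot, hker, inner_zero_left] at h
    simp only [Complex.ofReal_neg, neg_smul, add_neg_cancel_right, Complex.zero_re] at h
    nlinarith [mul_nonneg (sq_nonneg t) (neg_nonneg.mpr hv.le)]
  · rintro ⟨x, hx, hBx⟩
    have hline (t : ℝ) :
        qf B (x + (t : ℂ) • B x) = t * (2 * ‖B x‖ ^ 2 + t * qf B (B x)) := by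
      have hre : (⟪B x, B x⟫_ℂ).re = ‖B x‖ ^ 2 := inner_self_eq_norm_sq (𝕜 := ℂ) (B x)
      rw [qf_add_smul B hB, hx, hre]
      ring
    have ha : 0 < ‖B x‖ ^ 2 := by positivity
    set c := qf B (B x)
    set t := ‖B x‖ ^ 2 / (|c| + 1) with ht
    have htpos : 0 < t := by positivity
    have hbound : |t * c| ≤ ‖B x‖ ^ 2 := by
      rw [abs_mul, abs_of_pos htpos, ht, div_mul_eq_mul_div, div_le_iff₀ (by positivity)]
      nlinarith
    obtain ⟨hl, hr⟩ := abs_le.mp hbound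
    refine ⟨⟨x + (t : ℂ) • B x, ?_⟩, x + ((-t : ℝ) : ℂ) • B x, ?_⟩
    · rw [hline]
      exact mul_pos htpos (by linarith)
    · rw [hline]
      exact mul_neg_of_neg_of_pos (neg_lt_zero.mpr htpos) (by linarith)
end

section
/- Let B₁,…,B_m ∈ 𝓛(ℋ) be selfadjoint. If there exists x ∈ ℋ such that x ∈ ⋂_{j=1}^m Q_j and {B₁x,…,B_mx} is linearly independent in ℋ, then {B₁,…,B_m} is weakly indefinite. -/
open scoped InnerProductSpace

variable {H : Type*} [NormedAddCommGroup H] [InnerProductSpace ℂ H] [CompleteSpace H]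

/-- `Q(B)` : the set of neutral vectors of the quadratic form of `B`. -/
def Qset (B : H →L[ℂ] H) : Set H := {x : H | qf B x = 0}

/-- `B` is indefinite on a set `S` if its quadratic form takes both strictly positive
and strictly negative values on `S`. -/
def IndefiniteOn (B : H →L[ℂ] H) (S : Set H) : Prop :=
  (∃ x ∈ S, 0 < qf B x) ∧ (∃ x ∈ S, qf B x < 0)

/-- A family `{B₁,…,B_m}` is weakly indefinite if every nontrivial real linear
combination `∑ μᵢ Bᵢ` is indefinite. -/
def WeaklyIndefinite {m : ℕ} (B : Fin m → (H →L[ℂ] H)) : Prop :=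
  ∀ μ : Fin m → ℝ, μ ≠ 0 → Indefinite (∑ i, μ i • B i)

/-- A family `{B₁,…,B_m}` is indefinite if each `B_j` is indefinite on `⋂_{i≠j} Qᵢ`. -/
def IndefiniteFamily {m : ℕ} (B : Fin m → (H →L[ℂ] H)) : Prop :=
  ∀ j : Fin m, IndefiniteOn (B j) {x : H | ∀ i, i ≠ j → qf (B i) x = 0}

theorem qf_add_real_smul_apply {A : H →L[ℂ] H} (hA : IsSelfAdjoint A) (x : H) (t : ℝ) :
    qf A (x + (t : ℂ) • A x) = qf A x + 2 * t * ‖A x‖ ^ 2 + t ^ 2 * qf A (A x) := by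
  have h : ⟪A (A x), x⟫_ℂ = ⟪A x, A x⟫_ℂ := hA.isSymmetric (A x) x
  simp only [qf, map_add, map_smul, inner_add_left, inner_add_right, inner_smul_left,
    inner_smul_right, h, inner_self_eq_norm_sq_to_K, Complex.conj_ofReal, Complex.add_re,
    Complex.re_ofReal_mul]
  simp only [Complex.coe_algebraMap, ← Complex.ofReal_pow, Complex.ofReal_re]
  ring

/-- A selfadjoint operator with a neutral vector outside its kernel is indefinite. -/
theorem Indefinite.of_qf_eq_zero {A : H →L[ℂ] H} (hA : IsSelfAdjoint A) {x : H}
    (hx : qf A x = 0) (hAx : A x ≠ 0) : Indefinite A := by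
  have hn : 0 < ‖A x‖ ^ 2 := by positivity
  set n := ‖A x‖ ^ 2
  set q := qf A (A x)
  have hq : 0 < |q| + 1 := by positivity
  set ε := n / (|q| + 1)
  have hε : 0 < ε := div_pos hn hq
  have hεq : ε * (|q| + 1) = n := div_mul_cancel₀ n hq.ne'
  have hsq : 0 < ε ^ 2 := by positivity
  have key : ∀ t : ℝ, qf A (x + (t : ℂ) • A x) = 2 * t * n + t ^ 2 * q := fun t => by
    rw [qf_add_real_smul_apply hA, hx, zero_add]
  have hprod : ε * n = ε ^ 2 * |q| + ε ^ 2 := by rw [← hεq]; ring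
  have hle := mul_le_mul_of_nonneg_left (le_abs_self q) hsq.le
  have hge := mul_le_mul_of_nonneg_left (neg_abs_le q) hsq.le
  have habs : 0 ≤ ε ^ 2 * |q| := by positivity
  refine ⟨⟨x + (ε : ℂ) • A x, ?_⟩, ⟨x + ((-ε : ℝ) : ℂ) • A x, ?_⟩⟩
  · rw [key]
    linarith
  · rw [key, neg_sq]
    linarith

/-- If there is `x ∈ ⋂_{j} Q_j` with `{B₁x,…,B_mx}` linearly independent, then
`{B₁,…,B_m}` is weakly indefinite. -/
theorem weaklyIndefinite_of_common_neutral_linearIndependent {m : ℕ}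
    (B : Fin m → (H →L[ℂ] H)) (hB : ∀ i, IsSelfAdjoint (B i)) (x : H)
    (hxQ : ∀ j, qf (B j) x = 0)
    (hli : LinearIndependent ℝ (fun j => B j x)) :
    WeaklyIndefinite B := by
  intro μ hμ
  refine Indefinite.of_qf_eq_zero (x := x) ?_ ?_ ?_
  · exact isSelfAdjoint_sum _ fun i _ => (IsSelfAdjoint.all (μ i)).smul (hB i)
  · simp only [qf] at hxQ
    simp [qf, inner_smul_left_eq_smul, hxQ]
  · intro h
    refine hμ (funext (Fintype.linearIndependent_iff.mp hli μ ?_))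
    simpa using h
end

section
/- Let B₁, B₂, B₃ ∈ 𝓛(ℋ) be indefinite selfadjoint operators. Then {B₁, B₂, B₃} is weakly indefinite if and only if for every j = 1, 2, 3 the operator B_j is indefinite on ⋂_{i≠j} Qᵢ (i.e. its quadratic form takes both positive and negative values on ⋂_{i≠j} Qᵢ). -/
open scoped InnerProductSpace

variable {H : Type*} [NormedAddCommGroup H] [InnerProductSpace ℂ H] [CompleteSpace H]

/-- A selfadjoint operator `B` satisfies the polarization expansion of its quadratic form along
`α x + β y` with `α` real. -/
lemma qf_real_smul_add_smul {B : H →L[ℂ] H} (hB : IsSelfAdjoint B) (x y : H) (a : ℝ) (β : ℂ) :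
    qf B ((a : ℂ) • x + β • y) =
      a ^ 2 * qf B x + Complex.normSq β * qf B y +
        2 * ((a * β).re * (⟪B x, y⟫_ℂ).re - (a * β).im * (⟪B x, y⟫_ℂ).im) := by
  have hsym : ⟪B y, x⟫_ℂ = starRingEnd ℂ ⟪B x, y⟫_ℂ := by
    rw [inner_conj_symm, ← ContinuousLinearMap.adjoint_inner_right,
      ContinuousLinearMap.isSelfAdjoint_iff'.mp hB]
  simp only [qf, map_add, map_smul, inner_add_left, inner_add_right, inner_smul_left,
    inner_smul_right, hsym, Complex.add_re, Complex.mul_re, Complex.mul_im, Complex.conj_re,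
    Complex.conj_im, Complex.conj_ofReal, Complex.ofReal_re, Complex.ofReal_im,
    Complex.normSq_apply, Complex.add_im]
  ring

omit [CompleteSpace H] in
lemma qf_ofReal_smul (B : H →L[ℂ] H) (a : ℝ) (x : H) : qf B ((a : ℂ) • x) = a ^ 2 * qf B x := by
  simp only [qf, map_smul, inner_smul_left, inner_smul_right, Complex.mul_re, Complex.mul_im,
    Complex.conj_ofReal, Complex.ofReal_re, Complex.ofReal_im]
  ring

omit [CompleteSpace H] in
lemma qf_sum_smul {m : ℕ} (μ : Fin m → ℝ) (B : Fin m → (H →L[ℂ] H)) (x : H) :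
    qf (∑ i, μ i • B i) x = ∑ i, μ i * qf (B i) x := by
  simp [qf, inner_smul_left_eq_smul]

/-- On any line in the direction of a nonzero Hermitian matrix `!![s, w; conj w, t]` through the
identity there is a positive semidefinite matrix of rank one. -/
lemma exists_rank_one_on_line (s t u v : ℝ) (h : ¬(s = 0 ∧ t = 0 ∧ u = 0 ∧ v = 0)) :
    ∃ l : ℝ, 0 ≤ 1 + l * s ∧ 0 ≤ 1 + l * t ∧
      (1 + l * s) * (1 + l * t) = (l * u) ^ 2 + (l * v) ^ 2 := by
  set r := √((s - t) ^ 2 + 4 * (u ^ 2 + v ^ 2)) with hr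
  have hr2 : r ^ 2 = (s - t) ^ 2 + 4 * (u ^ 2 + v ^ 2) := Real.sq_sqrt (by positivity)
  have hr0 : 0 ≤ r := Real.sqrt_nonneg _
  have hst : |s - t| ≤ r := Real.abs_le_sqrt (by nlinarith [sq_nonneg u, sq_nonneg v])
  obtain ⟨hst1, hst2⟩ := abs_le.mp hst
  have hcase : s + t - r < 0 ∨ 0 < s + t + r := by
    by_contra! hc
    have hr' : r = 0 := by linarith
    rw [hr'] at hr2 hc
    have hu : u = 0 := by nlinarith [sq_nonneg u, sq_nonneg v, sq_nonneg (s - t)]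
    have hv : v = 0 := by nlinarith [sq_nonneg u, sq_nonneg v, sq_nonneg (s - t)]
    exact h ⟨by linarith, by linarith, hu, hv⟩
  rcases hcase with hm | hm
  · refine ⟨-2 / (s + t - r), ?_, ?_, ?_⟩
    · have : 1 + -2 / (s + t - r) * s = (s - t + r) / -(s + t - r) := by
        field_simp [hm.ne]; ring
      rw [this]; exact div_nonneg (by linarith) (by linarith)
    · have : 1 + -2 / (s + t - r) * t = (t - s + r) / -(s + t - r) := by
        field_simp [hm.ne]; ring
      rw [this]; exact div_nonneg (by linarith) (by linarith)
    · have := hm.ne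
      field_simp
      linear_combination hr2
  · refine ⟨-2 / (s + t + r), ?_, ?_, ?_⟩
    · have : 1 + -2 / (s + t + r) * s = (t - s + r) / (s + t + r) := by
        field_simp [hm.ne']; ring
      rw [this]; exact div_nonneg (by linarith) hm.le
    · have : 1 + -2 / (s + t + r) * t = (s - t + r) / (s + t + r) := by
        field_simp [hm.ne']; ring
      rw [this]; exact div_nonneg (by linarith) hm.le
    · have := hm.ne'
      field_simp
      linear_combination hr2

/-- A positive semidefinite Hermitian `2 × 2` matrix of determinant zero is of the form
`z zᴴ` with one real coordinate. -/
lemma exists_factor_of_mul_eq_normSq {p q : ℝ} {w : ℂ} (hp : 0 ≤ p) (hq : 0 ≤ q)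
    (h : p * q = Complex.normSq w) :
    ∃ (a : ℝ) (β : ℂ), a ^ 2 = p ∧ Complex.normSq β = q ∧ a * β = w := by
  rcases hp.eq_or_lt with rfl | hp
  · have hw : w = 0 := by simpa using h.symm
    exact ⟨0, (√q : ℝ), by simp, by simp [Complex.normSq_ofReal, Real.mul_self_sqrt hq], by simp [hw]⟩
  · have hs : (√p : ℝ) ≠ 0 := (Real.sqrt_pos.mpr hp).ne'
    refine ⟨√p, w / (√p : ℝ), Real.sq_sqrt hp.le, ?_, ?_⟩
    · rw [Complex.normSq_div, Complex.normSq_ofReal, Real.mul_self_sqrt hp.le, ← h]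
      field_simp
    · have : ((√p : ℝ) : ℂ) ≠ 0 := by exact_mod_cast hs
      field_simp

/-- The joint range of three Hermitian forms is closed under addition. -/
lemma exists_qf_eq_add {B : Fin 3 → (H →L[ℂ] H)} (hB : ∀ i, IsSelfAdjoint (B i)) (x y : H) :
    ∃ z, ∀ i, qf (B i) z = qf (B i) x + qf (B i) y := by
  let M : Matrix (Fin 3) (Fin 4) ℝ := Matrix.of fun i =>
    ![qf (B i) x, qf (B i) y, 2 * (⟪B i x, y⟫_ℂ).re, -(2 * (⟪B i x, y⟫_ℂ).im)]
  obtain ⟨k, hk, hk0⟩ := Submodule.exists_mem_ne_zero_of_ne_bot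
    (M.mulVecLin.ker_ne_bot_of_finrank_lt (by simp))
  have hker : ∀ i, qf (B i) x * k 0 + qf (B i) y * k 1 + 2 * (⟪B i x, y⟫_ℂ).re * k 2
      - 2 * (⟪B i x, y⟫_ℂ).im * k 3 = 0 := by
    intro i
    have := congrFun (LinearMap.mem_ker.mp hk) i
    simp [M, Matrix.mulVec, dotProduct, Fin.sum_univ_four] at this
    linarith
  obtain ⟨l, hs, ht, hdet⟩ := exists_rank_one_on_line (k 0) (k 1) (k 2) (k 3) (by
    rintro ⟨h0, h1, h2, h3⟩
    refine hk0 (funext fun i => ?_)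
    fin_cases i <;> simpa)
  obtain ⟨a, β, ha, hβ, haβ⟩ := exists_factor_of_mul_eq_normSq (w := ⟨l * k 2, l * k 3⟩) hs ht (by
    rw [hdet, Complex.normSq_mk]; ring)
  refine ⟨(a : ℂ) • x + β • y, fun i => ?_⟩
  rw [qf_real_smul_add_smul (hB i), ha, hβ, haβ]
  linear_combination l * hker i

/-- A convex cone in `ℝᵐ` on which every nonzero linear functional takes positive values is the
whole space. -/
lemma eq_univ_of_forall_exists_pos {m : ℕ} {W : Set (Fin m → ℝ)} (h0 : 0 ∈ W)
    (hadd : ∀ x ∈ W, ∀ y ∈ W, x + y ∈ W) (hsmul : ∀ c : ℝ, 0 ≤ c → ∀ x ∈ W, c • x ∈ W)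
    (hpos : ∀ f : (Fin m → ℝ) →ₗ[ℝ] ℝ, f ≠ 0 → ∃ x ∈ W, 0 < f x) : W = Set.univ := by
  have hconv : Convex ℝ W := fun x hx y hy a b ha hb _ =>
    hadd _ (hsmul a ha x hx) _ (hsmul b hb y hy)
  have hint : (interior W).Nonempty := by
    rw [hconv.interior_nonempty_iff_affineSpan_eq_top]
    by_contra hne
    have hspan : Submodule.span ℝ W ≠ ⊤ := by
      intro hs
      refine hne ?_
      have := affineSpan_insert_zero (k := ℝ) (s := W)
      rw [Set.insert_eq_of_mem h0, hs] at this
      exact SetLike.coe_injective (by simpa using this)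
    obtain ⟨f, hf, hle⟩ := Submodule.exists_le_ker_of_lt_top _ hspan.lt_top
    obtain ⟨x, hx, hfx⟩ := hpos f hf
    exact hfx.ne' (hle (Submodule.subset_span hx))
  by_contra hW
  obtain ⟨v, hv⟩ := (Set.ne_univ_iff_exists_notMem W).mp hW
  obtain ⟨f, hf, hle⟩ := geometric_hahn_banach_of_nonempty_interior_point hconv
    (fun h => hv (interior_subset h)) hint
  obtain ⟨x, hx, hfx⟩ := hpos f.toLinearMap (by
    intro h; exact hf (ContinuousLinearMap.coe_injective h))
  have hfx : 0 < f x := hfx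
  have hv0 : 0 ≤ f v := by simpa using hle 0 h0
  have := hle _ (hsmul ((f v + 1) / f x) (by positivity) x hx)
  rw [map_smul, smul_eq_mul, div_mul_cancel₀ _ hfx.ne'] at this
  linarith

omit [CompleteSpace H] in
lemma IndefiniteFamily.weaklyIndefinite {m : ℕ} {B : Fin m → (H →L[ℂ] H)}
    (h : IndefiniteFamily B) : WeaklyIndefinite B := by
  intro μ hμ
  obtain ⟨j, hj⟩ := Function.ne_iff.mp hμ
  obtain ⟨⟨x, hx, hxp⟩, ⟨y, hy, hyn⟩⟩ := h j
  have key : ∀ z : H, (∀ i, i ≠ j → qf (B i) z = 0) →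
      qf (∑ i, μ i • B i) z = μ j * qf (B j) z := by
    intro z hz
    rw [qf_sum_smul]
    exact Finset.sum_eq_single j (fun i _ hi => by rw [hz i hi, mul_zero]) (by simp)
  rcases lt_or_gt_of_ne hj with hj | hj
  · exact ⟨⟨y, by rw [key y hy]; exact mul_pos_of_neg_of_neg hj hyn⟩,
      ⟨x, by rw [key x hx]; exact mul_neg_of_neg_of_pos hj hxp⟩⟩
  · exact ⟨⟨x, by rw [key x hx]; exact mul_pos hj hxp⟩,
      ⟨y, by rw [key y hy]; exact mul_neg_of_pos_of_neg hj hyn⟩⟩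

/-- The joint range of a weakly indefinite triple of Hermitian forms is all of `ℝ³`. -/
lemma WeaklyIndefinite.exists_qf_eq {B : Fin 3 → (H →L[ℂ] H)} (hB : ∀ i, IsSelfAdjoint (B i))
    (h : WeaklyIndefinite B) (c : Fin 3 → ℝ) : ∃ x, ∀ i, qf (B i) x = c i := by
  have huniv : Set.range (fun (x : H) i => qf (B i) x) = Set.univ := by
    refine eq_univ_of_forall_exists_pos ⟨0, by ext i; simp [qf]⟩ ?_ ?_ ?_
    · rintro _ ⟨x, rfl⟩ _ ⟨y, rfl⟩
      obtain ⟨z, hz⟩ := exists_qf_eq_add hB x y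
      exact ⟨z, funext hz⟩
    · rintro c hc _ ⟨x, rfl⟩
      exact ⟨((√c : ℝ) : ℂ) • x, funext fun i => by
        beta_reduce
        rw [qf_ofReal_smul, Real.sq_sqrt hc, Pi.smul_apply, smul_eq_mul]⟩
    · intro f hf
      obtain ⟨⟨x, hx⟩, -⟩ := h (fun i => f (Pi.single i 1)) (by
        intro hz
        exact hf (LinearMap.pi_ext' fun i => LinearMap.ext_ring (by simpa using congrFun hz i)))
      refine ⟨_, ⟨x, rfl⟩, ?_⟩
      rw [qf_sum_smul] at hx
      beta_reduce
      rw [← Finset.univ_sum_single (fun i => qf (B i) x), map_sum]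
      refine hx.trans_eq (Finset.sum_congr rfl fun i _ => ?_)
      rw [mul_comm, ← smul_eq_mul, ← map_smul, ← Pi.single_smul, smul_eq_mul, mul_one]
  obtain ⟨x, hx⟩ := huniv.symm ▸ Set.mem_univ c
  exact ⟨x, congrFun hx⟩

/-- For three indefinite selfadjoint operators, `{B₁, B₂, B₃}` is weakly indefinite iff
each `B_j` is indefinite on `⋂_{i≠j} Qᵢ`. -/
theorem weaklyIndefinite_triple_iff (B₁ B₂ B₃ : H →L[ℂ] H)
    (h1 : IsSelfAdjoint B₁) (h2 : IsSelfAdjoint B₂) (h3 : IsSelfAdjoint B₃)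
    (hi1 : Indefinite B₁) (hi2 : Indefinite B₂) (hi3 : Indefinite B₃) :
    WeaklyIndefinite ![B₁, B₂, B₃] ↔ IndefiniteFamily ![B₁, B₂, B₃] := by
  refine ⟨fun h j => ?_, IndefiniteFamily.weaklyIndefinite⟩
  have hB : ∀ i, IsSelfAdjoint (![B₁, B₂, B₃] i) := by
    intro i
    fin_cases i <;> assumption
  obtain ⟨x, hx⟩ := h.exists_qf_eq hB (Pi.single j 1)
  obtain ⟨y, hy⟩ := h.exists_qf_eq hB (Pi.single j (-1))
  refine ⟨⟨x, fun i hi => ?_, ?_⟩, ⟨y, fun i hi => ?_, ?_⟩⟩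
  · simp [hx, hi]
  · simp [hx]
  · simp [hy, hi]
  · simp [hy]
end

section
/- Let {B₁,…,B_m} be an indefinite set of selfadjoint operators on ℋ. Fix k ∈ {1,…,m}, take y ∈ 𝒫_k⁻ ∩ ⋂_{i≠k} Qᵢ and z ∈ 𝒫_k⁺ ∩ ⋂_{i≠k} Qᵢ, and let 𝒮 = {αy + βz : α, β ∈ ℝ}. Then either 𝒮 ⊆ ⋂_{i≠k} Qᵢ, or there exists l ≠ k such that 𝒮 ∩ Q_k ∩ Q_l = {0}. -/
open scoped InnerProductSpace

variable {H : Type*} [NormedAddCommGroup H] [InnerProductSpace ℂ H] [CompleteSpace H]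

/-- Expansion of the quadratic form along a real plane. -/
theorem qf_smul_add_smul_s11 {E : Type*} [NormedAddCommGroup E] [InnerProductSpace ℂ E]
    (B : E →L[ℂ] E) (y z : E) (a b : ℝ) :
    qf B (a • y + b • z) =
      a ^ 2 * qf B y + b ^ 2 * qf B z + a * b * ((⟪B y, z⟫_ℂ).re + (⟪B z, y⟫_ℂ).re) := by
  simp only [qf, ← Complex.coe_smul, map_add, map_smul, inner_add_left, inner_add_right,
    inner_smul_left, inner_smul_right, Complex.conj_ofReal, Complex.add_re, Complex.re_ofReal_mul]
  ring

/-- Dichotomy for the real plane `𝒮 = {αy + βz}` spanned by `y ∈ 𝒫_k⁻ ∩ ⋂_{i≠k} Qᵢ` and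
`z ∈ 𝒫_k⁺ ∩ ⋂_{i≠k} Qᵢ`: either `𝒮 ⊆ ⋂_{i≠k} Qᵢ`, or `𝒮 ∩ Q_k ∩ Q_l = {0}` for some
`l ≠ k`. -/
theorem plane_dichotomy {m : ℕ} (B : Fin m → (H →L[ℂ] H))
    (hB : ∀ i, IsSelfAdjoint (B i)) (hind : IndefiniteFamily B) (k : Fin m) (y z : H)
    (hy : qf (B k) y < 0) (hyQ : ∀ i, i ≠ k → qf (B i) y = 0)
    (hz : 0 < qf (B k) z) (hzQ : ∀ i, i ≠ k → qf (B i) z = 0) :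
    (∀ a b : ℝ, ∀ i, i ≠ k → qf (B i) (a • y + b • z) = 0) ∨
    (∃ l, l ≠ k ∧ ∀ a b : ℝ, qf (B k) (a • y + b • z) = 0 →
        qf (B l) (a • y + b • z) = 0 → a • y + b • z = 0) := by
  by_cases h : ∃ l, l ≠ k ∧ (⟪B l y, z⟫_ℂ).re + (⟪B l z, y⟫_ℂ).re ≠ 0
  · obtain ⟨l, hl, hc⟩ := h
    refine Or.inr ⟨l, hl, fun a b hk hl0 => ?_⟩
    rw [qf_smul_add_smul_s11, hyQ l hl, hzQ l hl] at hl0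
    have hab : a * b = 0 := by simpa [hc] using hl0
    rw [qf_smul_add_smul_s11] at hk
    obtain rfl | rfl := mul_eq_zero.mp hab
    · simp_all [hz.ne']
    · simp_all [hy.ne]
  · push Not at h
    refine Or.inl fun a b i hi => ?_
    rw [qf_smul_add_smul_s11, hyQ i hi, hzQ i hi, h i hi]
    ring
end

section
/- Let B₁,…,B_m ∈ 𝓛(ℋ) be selfadjoint such that {B₁,…,B_m} is weakly indefinite, and suppose there exists a selfadjoint B ∈ 𝓛(ℋ) such that {B₁,…,B_m, B} is linearly independent. If for every selfadjoint A ∈ 𝓛(ℋ) the implication '⟨Ax, x⟩ ≥ 0 for all x ∈ ⋂_{i=1}^m Qᵢ implies there exist λ₁,…,λ_m ∈ ℝ with A + ∑ᵢ λᵢBᵢ ≥ 0' holds, then ⋂_{i=1}^m Qᵢ ≠ {0}. -/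
open scoped InnerProductSpace

variable {H : Type*} [NormedAddCommGroup H] [InnerProductSpace ℂ H] [CompleteSpace H]

lemma qf_add (A B : H →L[ℂ] H) (x : H) : qf (A + B) x = qf A x + qf B x := by
  simp [qf]

lemma qf_neg (A : H →L[ℂ] H) (x : H) : qf (-A) x = -qf A x := by
  simp [qf]

lemma qf_zero_right (A : H →L[ℂ] H) : qf A 0 = 0 := by
  simp [qf]

/-- A selfadjoint operator whose quadratic form vanishes is zero. -/
lemma eq_zero_of_qf_eq_zero {A : H →L[ℂ] H} (hA : IsSelfAdjoint A) (h : ∀ x, qf A x = 0) :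
    A = 0 := by
  have key : ∀ x : H, ⟪A x, x⟫_ℂ = 0 := fun x =>
    Complex.ext (h x) (hA.isSymmetric.im_inner_apply_self x)
  exact ContinuousLinearMap.coe_injective ((inner_map_self_eq_zero (A : H →ₗ[ℂ] H)).1 key)

/-- The only positive semidefinite combination of a weakly indefinite family is the trivial one. -/
lemma WeaklyIndefinite.eq_zero_of_posSemidef {m : ℕ} {B : Fin m → (H →L[ℂ] H)}
    (hw : WeaklyIndefinite B) {μ : Fin m → ℝ} (h : PosSemidef (∑ i, μ i • B i)) : μ = 0 := by
  by_contra hμ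
  obtain ⟨x, hx⟩ := (hw μ hμ).2
  exact hx.not_ge (h x)

/-- If `{B₁,…,B_m}` is weakly indefinite, can be extended to a linearly independent set
by some selfadjoint `B`, and the generalized Krein–Šmul'jan implication holds for every
selfadjoint `A`, then `⋂ᵢ Qᵢ ≠ {0}`. -/
theorem common_neutral_of_KS_property {m : ℕ} (B : Fin m → (H →L[ℂ] H))
    (hB : ∀ i, IsSelfAdjoint (B i)) (hw : WeaklyIndefinite B)
    (hex : ∃ B' : H →L[ℂ] H, IsSelfAdjoint B' ∧ LinearIndependent ℝ (Fin.snoc B B'))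
    (hKS : ∀ A : H →L[ℂ] H, IsSelfAdjoint A →
      (∀ x : H, (∀ i, qf (B i) x = 0) → 0 ≤ qf A x) →
      ∃ l : Fin m → ℝ, PosSemidef (A + ∑ i, l i • B i)) :
    ∃ x : H, x ≠ 0 ∧ ∀ i, qf (B i) x = 0 := by
  by_contra! hne
  have hQ : ∀ x : H, (∀ i, qf (B i) x = 0) → x = 0 := by
    intro x hx
    by_contra h0
    obtain ⟨i, hi⟩ := hne x h0
    exact hi (hx i)
  have hpos : ∀ A : H →L[ℂ] H, IsSelfAdjoint A →
      ∃ l : Fin m → ℝ, PosSemidef (A + ∑ i, l i • B i) := fun A hA =>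
    hKS A hA fun x hx => by rw [hQ x hx, qf_zero_right]
  obtain ⟨B', hB', hli⟩ := hex
  obtain ⟨l, hl⟩ := hpos B' hB'
  obtain ⟨k, hk⟩ := hpos (-B') hB'.neg
  have hlk : l + k = 0 := hw.eq_zero_of_posSemidef fun x => by
    have hsum : ∑ i, (l + k) i • B i = (B' + ∑ i, l i • B i) + (-B' + ∑ i, k i • B i) := by
      simp only [Pi.add_apply, add_smul, Finset.sum_add_distrib]
      abel
    rw [hsum, qf_add]
    exact add_nonneg (hl x) (hk x)
  have hneg : -B' + ∑ i, k i • B i = -(B' + ∑ i, l i • B i) := by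
    rw [eq_neg_of_add_eq_zero_right hlk]
    simp only [Pi.neg_apply, neg_smul, Finset.sum_neg_distrib]
    abel
  have hsa : IsSelfAdjoint (B' + ∑ i, l i • B i) :=
    hB'.add (isSelfAdjoint_sum _ fun i _ => (IsSelfAdjoint.all (l i)).smul (hB i))
  have hzero : B' + ∑ i, l i • B i = 0 := eq_zero_of_qf_eq_zero hsa fun x => by
    have h := hk x
    rw [hneg, qf_neg] at h
    exact le_antisymm (neg_nonneg.1 h) (hl x)
  refine (linearIndependent_finSnoc.1 hli).2 ?_
  rw [eq_neg_of_add_eq_zero_left hzero]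
  exact neg_mem <| sum_mem fun i _ =>
    Submodule.smul_mem _ _ (Submodule.subset_span (Set.mem_range_self i))
end

section
/- Let B ∈ 𝓛(ℋ) be selfadjoint and let {y, z} be a linearly independent set contained in Q(B). Then B is semidefinite on the real subspace {αy + βz : α, β ∈ ℝ} (i.e. ⟨Bx, x⟩ has constant sign on it) if and only if Re⟨By, z⟩ = 0; in that case ⟨Bx, x⟩ = 0 for all x in this subspace. -/
open scoped InnerProductSpace

variable {H : Type*} [NormedAddCommGroup H] [InnerProductSpace ℂ H] [CompleteSpace H]

/-- On a real plane spanned by two isotropic vectors of a selfadjoint operator, the quadratic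
form is given by its cross term. -/
theorem qf_smul_add_smul_of_isotropic {B : H →L[ℂ] H} (hB : IsSelfAdjoint B) {y z : H}
    (hy : qf B y = 0) (hz : qf B z = 0) (a b : ℝ) :
    qf B (a • y + b • z) = 2 * (a * b) * (⟪B y, z⟫_ℂ).re := by
  have hzy : (⟪B z, y⟫_ℂ).re = (⟪B y, z⟫_ℂ).re := by
    have h : ⟪B z, y⟫_ℂ = ⟪z, B y⟫_ℂ := hB.isSymmetric z y
    rw [h, ← inner_conj_symm z (B y), Complex.conj_re]
  unfold qf at *
  rw [← Complex.coe_smul a y, ← Complex.coe_smul b z]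
  simp only [map_add, map_smul, inner_add_left, inner_add_right, inner_smul_left,
    inner_smul_right, Complex.conj_ofReal, Complex.add_re, Complex.re_ofReal_mul, hy, hz, hzy]
  ring

/-- For a selfadjoint `B` and a linearly independent pair `{y, z} ⊆ Q(B)`, `B` is
semidefinite on the real plane `{αy + βz : α, β ∈ ℝ}` iff `Re⟨By, z⟩ = 0`; in that
case the quadratic form vanishes identically on this plane. -/
theorem semidefinite_on_plane_iff (B : H →L[ℂ] H) (hB : IsSelfAdjoint B) (y z : H)
    (hy : qf B y = 0) (hz : qf B z = 0) (hli : LinearIndependent ℝ ![y, z]) :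
    (((∀ a b : ℝ, 0 ≤ qf B (a • y + b • z)) ∨ (∀ a b : ℝ, qf B (a • y + b • z) ≤ 0)) ↔
      (⟪B y, z⟫_ℂ).re = 0) ∧
    ((⟪B y, z⟫_ℂ).re = 0 → ∀ a b : ℝ, qf B (a • y + b • z) = 0) := by
  simp only [qf_smul_add_smul_of_isotropic hB hy hz]
  refine ⟨⟨?_, fun h => Or.inl fun a b => by simp [h]⟩, fun h a b => by simp [h]⟩
  rintro (h | h) <;> linarith [h 1 1, h 1 (-1)]
end
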